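/- (Theorem 3, Upper Bound of QFI for partial perturbation with pattern of multipartite entanglement.) Consider N particles with local Hilbert spaces ℂ^{d_1},…,ℂ^{d_N}, a distinguished subset B ⊆ {1,…,N} of size N_B, Hermitian local operators O_i on ℂ^{d_i} for i ∈ B with spectral widths Δ_i = λ_max(O_i) − λ_min(O_i) listed in descending order Δ_1 ≥ ⋯ ≥ Δ_{N_B}, and O_B = Σ_{i∈B} Õ_i acting on the total space. Suppose the density matrix ρ is k'-producible in the N_B particles of B, i.e. ρ = Σ_ν p_ν |Ψ_ν⟩⟨Ψ_ν| where each Ψ_ν factorizes over some partition of {1,…,N} in which every block contains at most k' particles from B (blocks may contain arbitrarily many particles outside B). Then F_Q[ρ,O_B] ≤ F_B(k';{Δ_i}) := Σ_{l=0}^{q_B−1} (Σ_{j=1}^{k'} Δ_{k'l+j})² + (Σ_{j=1}^{r_B} Δ_{k'q_B+j})², where q_B = ⌊N_B/k'⌋ and r_B = N_B − k'q_B. -/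

import Mathlib

open Matrix

/-- Quantum Fisher information of a density matrix given by its eigenvalues `p`
and orthonormal eigenbasis `e`, with respect to the operator `O`. -/
noncomputable def QFI {ι : Type*} [Fintype ι] (p : ι → ℝ) (e : ι → ι → ℂ)
    (O : Matrix ι ι ℂ) : ℝ :=
  2 * ∑ l, ∑ l', if 0 < p l + p l' then
    (p l - p l') ^ 2 / (p l + p l') * Complex.normSq (star (e l) ⬝ᵥ O.mulVec (e l'))
  else 0

/-- The operator acting as `A` on the `i`-th tensor factor and as the identity on
all other factors, as a matrix on the product index set `Π j, Fin (d j)`. -/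
noncomputable def localOp {N : ℕ} {d : Fin N → ℕ} (i : Fin N)
    (A : Matrix (Fin (d i)) (Fin (d i)) ℂ) :
    Matrix (∀ j, Fin (d j)) (∀ j, Fin (d j)) ℂ :=
  fun x y => A (x i) (y i) * (if ∀ j, j ≠ i → x j = y j then 1 else 0)

/-- A pure state `Ψ` is `k'`-producible in the subset `B` if it factorizes over
some partition of the `N` particles (encoded as the fibers of a coloring
`c : Fin N → Fin M`) each of whose blocks contains at most `k'` indices from `B`
(blocks may contain arbitrarily many particles outside `B`). -/
def ProducibleIn {N : ℕ} (d : Fin N → ℕ) (B : Finset (Fin N)) (k' : ℕ)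
    (Ψ : (∀ i, Fin (d i)) → ℂ) : Prop :=
  ∃ (M : ℕ) (c : Fin N → Fin M),
    (∀ m, (Finset.univ.filter (fun i => c i = m ∧ i ∈ B)).card ≤ k') ∧
    ∃ φ : ∀ m : Fin M, ((∀ i : {i : Fin N // c i = m}, Fin (d i.val)) → ℂ),
      ∀ x, Ψ x = ∏ m, φ m (fun i => x i.val)

/-- The QFI upper-bound function for the `N_B` perturbed particles:
`F_B(k';{Δ}) = Σ_{l=0}^{q_B−1} (Σ_{j=1}^{k'} Δ_{k'l+j})² + (Σ_{j=1}^{r_B} Δ_{k'q_B+j})²`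
with `q_B = ⌊N_B/k'⌋`, `r_B = N_B − k'q_B` (0-based indices: `Δ 0` is `Δ_1`). -/
noncomputable def Fbound (NB k' : ℕ) (Δ : ℕ → ℝ) : ℝ :=
  (∑ l ∈ Finset.range (NB / k'), (∑ j ∈ Finset.range k', Δ (k' * l + j)) ^ 2)
    + (∑ j ∈ Finset.range (NB % k'), Δ (k' * (NB / k') + j)) ^ 2

lemma top_sum (f : ℕ → ℝ) (hf : Antitone f) (h0 : ∀ i, 0 ≤ f i) (U : Finset ℕ) (n : ℕ)
    (hU : U.card ≤ n) : ∑ i ∈ U, f i ≤ ∑ i ∈ Finset.range n, f i := by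
  classical
  have h1 := Finset.sum_inter_add_sum_sdiff U (Finset.range n) f
  have h2 := Finset.sum_inter_add_sum_sdiff (Finset.range n) U f
  have hc1 := Finset.card_sdiff_add_card_inter U (Finset.range n)
  have hc2 := Finset.card_sdiff_add_card_inter (Finset.range n) U
  rw [Finset.inter_comm] at h2 hc2
  have hc : ((U \ Finset.range n).card : ℝ) ≤ ((Finset.range n \ U).card : ℝ) := by
    rw [Finset.card_range] at hc2
    exact_mod_cast (by omega)
  have h3 : ∑ i ∈ U \ Finset.range n, f i ≤ (U \ Finset.range n).card • f n := by
    apply Finset.sum_le_card_nsmul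
    intro i hi
    simp at hi
    exact hf hi.2
  have h4 : (Finset.range n \ U).card • f n ≤ ∑ i ∈ Finset.range n \ U, f i := by
    apply Finset.card_nsmul_le_sum
    intro i hi
    simp at hi
    exact hf hi.1.le
  simp only [nsmul_eq_mul] at h3 h4
  nlinarith [mul_le_mul_of_nonneg_right hc (h0 n)]

lemma abel_nonneg (s u : ℕ → ℝ) (hs : Antitone s) (h0 : ∀ i, 0 ≤ s i)
    (hu : ∀ n, 0 ≤ ∑ i ∈ Finset.range n, u i) (n : ℕ) :
    0 ≤ ∑ i ∈ Finset.range n, s i * u i := by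
  have key : ∀ n, s n * ∑ i ∈ Finset.range n, u i ≤ ∑ i ∈ Finset.range n, s i * u i := by
    intro n
    induction n with
    | zero => simp
    | succ n ih =>
      have h1 : s (n+1) * ∑ i ∈ Finset.range (n+1), u i ≤ s n * ∑ i ∈ Finset.range (n+1), u i :=
        mul_le_mul_of_nonneg_right (hs (Nat.le_succ n)) (hu _)
      refine h1.trans ?_
      rw [Finset.sum_range_succ, Finset.sum_range_succ]
      linarith
  exact (mul_nonneg (h0 n) (hu n)).trans (key n)

lemma sum_blocks (f : ℕ → ℝ) (k n : ℕ) :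
    ∑ l ∈ Finset.range n, ∑ j ∈ Finset.range k, f (k * l + j) = ∑ i ∈ Finset.range (k * n), f i := by
  induction n with
  | zero => simp
  | succ n ih => rw [Finset.sum_range_succ, ih, Nat.mul_succ, Finset.sum_range_add]

lemma Fbound_ge (n k M : ℕ) (hk : 1 ≤ k) (Δ f : ℕ → ℝ) (hf : ∀ i, f i = if i < n then Δ i else 0) :
    ∑ l ∈ Finset.range M, (∑ j ∈ Finset.range k, f (k * l + j)) ^ 2 ≤ Fbound n k Δ := by
  have hdm := Nat.div_add_mod n k
  have hml := Nat.mod_lt n (show k > 0 by omega)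
  have h1 : ∑ l ∈ Finset.range M, (∑ j ∈ Finset.range k, f (k * l + j)) ^ 2
      ≤ ∑ l ∈ Finset.range (n / k + 1 + M), (∑ j ∈ Finset.range k, f (k * l + j)) ^ 2 := by
    apply Finset.sum_le_sum_of_subset_of_nonneg
    · exact Finset.range_mono (Nat.le_add_left _ _)
    · intros; positivity
  refine h1.trans (le_of_eq ?_)
  rw [Finset.sum_range_add, Finset.sum_range_succ]
  unfold Fbound
  have h2 : ∑ x ∈ Finset.range M, (∑ j ∈ Finset.range k, f (k * (n / k + 1 + x) + j)) ^ 2 = 0 := by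
    apply Finset.sum_eq_zero
    intro x _
    rw [Finset.sum_eq_zero, zero_pow two_ne_zero]
    intro j _
    rw [hf, if_neg]
    have : k * (n / k + 1 + x) = k * (n/k) + k + k * x := by ring
    have := Nat.zero_le (k * x)
    omega
  rw [h2, add_zero]
  congr 1
  · apply Finset.sum_congr rfl
    intro l hl
    congr 1
    apply Finset.sum_congr rfl
    intro j hj
    rw [hf, if_pos]
    simp at hl hj
    have : k * (l + 1) ≤ k * (n / k) := Nat.mul_le_mul_left _ hl
    rw [Nat.mul_succ] at this
    omega
  · congr 1
    rw [← Finset.sum_subset (s₁ := Finset.range (n % k)) (s₂ := Finset.range k) (f := fun j => f (k * (n / k) + j))]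
    · apply Finset.sum_congr rfl
      intro j hj
      simp at hj
      rw [hf, if_pos]
      omega
    · exact Finset.range_mono hml.le
    · intro x _ hx
      simp at hx
      rw [hf, if_neg]; omega

lemma comb (n M k : ℕ) (hk : 1 ≤ k) (c : Fin n → Fin M)
    (hc : ∀ m, (Finset.univ.filter (fun j => c j = m)).card ≤ k)
    (Δ : ℕ → ℝ) (hdesc : ∀ a b : ℕ, a ≤ b → b < n → Δ b ≤ Δ a) (h0 : ∀ j < n, 0 ≤ Δ j) :
    ∑ m, (∑ j with c j = m, Δ (j : Fin n).val) ^ 2 ≤ Fbound n k Δ := by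
  classical
  set f : ℕ → ℝ := fun i => if i < n then Δ i else 0 with hf
  have hf0 : ∀ i, 0 ≤ f i := by
    intro i; simp only [hf]; split_ifs with h
    · exact h0 i h
    · exact le_rfl
  have hfa : Antitone f := by
    intro a b hab
    simp only [hf]
    split_ifs with h1 h2 h2
    · exact hdesc a b hab h1
    · omega
    · exact h0 a h2
    · exact le_rfl
  set s : Fin M → ℝ := fun m => ∑ j with c j = m, Δ (j : Fin n).val with hs
  have hs0 : ∀ m, 0 ≤ s m := fun m => Finset.sum_nonneg fun j _ => h0 _ j.2
  set σ := Tuple.sort (fun m => - s m)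
  have hσ : Monotone ((fun m => - s m) ∘ σ) := Tuple.monotone_sort _
  set S : ℕ → ℝ := fun j => if h : j < M then s (σ ⟨j, h⟩) else 0 with hS
  have hS0 : ∀ i, 0 ≤ S i := by
    intro i; simp only [hS]; split_ifs
    · exact hs0 _
    · exact le_rfl
  have hSa : Antitone S := by
    intro a b hab
    simp only [hS]
    split_ifs with h1 h2 h2
    · have := @hσ ⟨a, h2⟩ ⟨b, h1⟩ hab
      simp only [Function.comp] at this
      linarith
    · omega
    · exact hs0 _
    · exact le_rfl
  set t : ℕ → ℝ := fun l => ∑ j ∈ Finset.range k, f (k * l + j) with ht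
  have hSF : ∀ F : ℝ → ℝ, ∑ i ∈ Finset.range M, F (S i) = ∑ m, F (s m) := by
    intro F
    rw [Finset.sum_range, ← Equiv.sum_comp σ (fun m => F (s m))]
    apply Finset.sum_congr rfl
    intro i _
    simp [hS]
  have hpart : ∀ j, 0 ≤ ∑ i ∈ Finset.range j, (t i - S i) := by
    intro j
    rw [Finset.sum_sub_distrib, ht, sum_blocks, sub_nonneg]
    set U : Finset (Fin n) := Finset.univ.filter (fun i => (σ.symm (c i)).val < j) with hU
    have e1 : ∑ i ∈ Finset.range j, S i = ∑ i ∈ U, Δ i.val := by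
      have : ∀ i ∈ Finset.range j, S i = ∑ a ∈ U with (σ.symm (c a)).val = i, Δ a.val := by
        intro i hi
        simp only [Finset.mem_range] at hi
        simp only [hS]
        split_ifs with h
        · simp only [hs]
          apply Finset.sum_congr _ (fun _ _ => rfl)
          ext a
          simp only [Finset.mem_filter, Finset.mem_univ, true_and, hU]
          constructor
          · intro h'; rw [h']; simpa using hi
          · rintro ⟨_, h'⟩
            rw [← Equiv.symm_apply_eq]
            exact Fin.ext h'
        · symm
          rw [Finset.filter_false_of_mem, Finset.sum_empty]
          intro a _ h'
          exact h (h' ▸ (σ.symm (c a)).2)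
      rw [Finset.sum_congr rfl this]
      apply Finset.sum_fiberwise_of_maps_to
      intro a ha
      simpa [hU] using ha
    have e2 : ∑ i ∈ U, Δ i.val = ∑ i ∈ U.map Fin.valEmbedding, f i := by
      rw [Finset.sum_map]
      apply Finset.sum_congr rfl
      intro i _
      simp [hf]
    rw [e1, e2]
    apply top_sum f hfa hf0
    rw [Finset.card_map]
    have : U.card = ∑ i ∈ Finset.range j, (U.filter (fun a => (σ.symm (c a)).val = i)).card := by
      apply Finset.card_eq_sum_card_fiberwise
      intro a ha
      simpa [hU] using ha
    rw [this]
    calc _ ≤ ∑ i ∈ Finset.range j, k := by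
          apply Finset.sum_le_sum
          intro i _
          by_cases h : i < M
          · refine (Finset.card_le_card ?_).trans (hc (σ ⟨i, h⟩))
            intro a ha
            simp only [Finset.mem_filter, Finset.mem_univ, true_and] at ha ⊢
            rw [← Equiv.symm_apply_eq]
            exact Fin.ext ha.2
          · rw [Finset.filter_false_of_mem]
            · simp
            · intro a _ h'
              exact h (h' ▸ (σ.symm (c a)).2)
      _ = k * j := by simp [mul_comm]
  have habel := abel_nonneg S (fun i => t i - S i) hSa hS0 hpart M
  have hge := Fbound_ge n k M hk Δ f (fun i => rfl)
  rw [← hSF (fun x => x ^ 2)]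
  refine le_trans ?_ hge
  have : 0 ≤ ∑ i ∈ Finset.range M, ((t i - S i) ^ 2 + 2 * (S i * (t i - S i))) := by
    rw [Finset.sum_add_distrib, ← Finset.mul_sum]
    have := Finset.sum_nonneg (s := Finset.range M) (fun i _ => sq_nonneg (t i - S i))
    linarith
  rw [← sub_nonneg, ← Finset.sum_sub_distrib]
  refine this.trans (le_of_eq ?_)
  apply Finset.sum_congr rfl
  intro i _
  simp only [ht]
  ring

open scoped InnerProductSpace in
lemma hil {H : Type*} [NormedAddCommGroup H] [InnerProductSpace ℂ H] {ι : Type*} {M : ℕ}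
    (ψ : H) (hψ : ‖ψ‖ = 1)
    (B : Finset ι) (c : ι → Fin M) (w : ι → H)
    (hcov : ∀ i ∈ B, ∀ j ∈ B, c i ≠ c j →
      ⟪w i, w j⟫_ℂ = ⟪w i, ψ⟫_ℂ * ⟪ψ, w j⟫_ℂ)
    (μ : ι → ℂ) (D : ι → ℝ) (h : ∀ i ∈ B, ‖w i - μ i • ψ‖ ≤ D i) :
    ‖∑ i ∈ B, w i - (∑ i ∈ B, ⟪ψ, w i⟫_ℂ) • ψ‖ ^ 2 ≤ ∑ m, (∑ i ∈ B with c i = m, D i) ^ 2 := by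
  have hψψ : ⟪ψ, ψ⟫_ℂ = 1 := by rw [inner_self_eq_norm_sq_to_K, hψ]; simp
  set v : ι → H := fun i => w i - ⟪ψ, w i⟫_ℂ • ψ with hv
  have hvψ : ∀ i, ⟪ψ, v i⟫_ℂ = 0 := by
    intro i; simp [hv, inner_sub_right, inner_smul_right, hψ]
  have hvv : ∀ i ∈ B, ∀ j ∈ B, c i ≠ c j → ⟪v i, v j⟫_ℂ = 0 := by
    intro i hi j hj hij
    simp only [hv, inner_sub_right, inner_sub_left, inner_smul_right, inner_smul_left, hψψ,
      hcov i hi j hj hij, inner_conj_symm]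
    ring
  set V : Fin M → H := fun m => ∑ i ∈ B with c i = m, v i with hV
  have e1 : ∑ i ∈ B, w i - (∑ i ∈ B, ⟪ψ, w i⟫_ℂ) • ψ = ∑ m, V m := by
    rw [hV, Finset.sum_fiberwise, hv, Finset.sum_sub_distrib, Finset.sum_smul]
  have hVV : ∀ m m', m ≠ m' → ⟪V m, V m'⟫_ℂ = 0 := by
    intro m m' hm
    simp only [hV, sum_inner, inner_sum]
    apply Finset.sum_eq_zero; intro i hi
    apply Finset.sum_eq_zero; intro j hj
    simp only [Finset.mem_filter] at hi hj
    exact hvv j hj.1 i hi.1 (by rw [hi.2, hj.2]; exact hm)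
  have e2 : ‖∑ m, V m‖ ^ 2 = ∑ m, ‖V m‖ ^ 2 := by
    have : ((‖∑ m, V m‖ ^ 2 : ℝ) : ℂ) = ((∑ m, ‖V m‖ ^ 2 : ℝ) : ℂ) := by
      push_cast
      have := inner_self_eq_norm_sq_to_K (𝕜 := ℂ) (∑ m, V m)
      simp only [Complex.coe_algebraMap] at this
      rw [← this, sum_inner]
      apply Finset.sum_congr rfl
      intro m _
      rw [inner_sum, Finset.sum_eq_single m, inner_self_eq_norm_sq_to_K]
      · rfl
      · intro m' _ hm; exact hVV _ _ hm.symm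
      · simp
    exact_mod_cast this
  rw [e1, e2]
  apply Finset.sum_le_sum
  intro m _
  have h3 : ∑ i ∈ B with c i = m, (w i - μ i • ψ) = V m + (∑ i ∈ B with c i = m, (⟪ψ, w i⟫_ℂ - μ i)) • ψ := by
    simp only [hV, hv, Finset.sum_sub_distrib, sub_smul, Finset.sum_smul]
    abel
  have h4 : ‖V m‖ ^ 2 ≤ ‖∑ i ∈ B with c i = m, (w i - μ i • ψ)‖ ^ 2 := by
    rw [h3, sq, sq, norm_add_sq_eq_norm_sq_add_norm_sq_of_inner_eq_zero (𝕜 := ℂ)]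
    · nlinarith [norm_nonneg ((∑ i ∈ B with c i = m, (⟪ψ, w i⟫_ℂ - μ i)) • ψ)]
    · rw [inner_smul_right, ← inner_conj_symm]
      simp [hV, inner_sum, hvψ]
  refine h4.trans ?_
  gcongr
  refine (norm_sum_le _ _).trans (Finset.sum_le_sum fun i hi => h i (Finset.mem_filter.1 hi).1)

lemma tr_form {ι : Type*} [Fintype ι] [DecidableEq ι] (R : Matrix ι ι ℂ) (u : ι → ℂ) :
    (R * vecMulVec u (star u)).trace = star u ⬝ᵥ R *ᵥ u := by
  rw [mul_vecMulVec, trace_vecMulVec, dotProduct_comm]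

open scoped ComplexOrder in
lemma re_self_nonneg {ι : Type*} [Fintype ι] (v : ι → ℂ) : 0 ≤ (star v ⬝ᵥ v).re :=
  (Complex.le_def.1 (dotProduct_star_self_nonneg v)).1

lemma qfi_le {ι : Type*} [Fintype ι] [DecidableEq ι] (p : ι → ℝ) (e : ι → ι → ℂ) (O : Matrix ι ι ℂ)
    (hO : O.IsHermitian)
    (horth : ∀ x y, star (e x) ⬝ᵥ e y = if x = y then 1 else 0)
    (hp : ∀ x, 0 ≤ p x) (K : ℕ) (q : Fin K → ℝ) (Ψ : Fin K → ι → ℂ)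
    (hq : ∀ ν, 0 ≤ q ν) (a : Fin K → ℝ)
    (hρ : ∑ x, (p x : ℂ) • Matrix.vecMulVec (e x) (star (e x))
        = ∑ ν, (q ν : ℂ) • Matrix.vecMulVec (Ψ ν) (star (Ψ ν))) :
    QFI p e O ≤ 4 * ∑ ν, q ν *
      (star (O *ᵥ Ψ ν - (a ν : ℂ) • Ψ ν) ⬝ᵥ (O *ᵥ Ψ ν - (a ν : ℂ) • Ψ ν)).re := by
  set E : Matrix ι ι ℂ := Matrix.of fun x y => e y x with hE
  have hform : ∀ (R : Matrix ι ι ℂ) x y, star (e x) ⬝ᵥ R *ᵥ e y = (Eᴴ * R * E) x y := by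
    intro R x y
    rw [Matrix.mul_assoc, Matrix.mul_apply]
    rfl
  have hEE : Eᴴ * E = 1 := by
    ext x y
    have := hform 1 x y
    rw [Matrix.mul_one, Matrix.one_mulVec, horth] at this
    rw [← this, Matrix.one_apply]
  set A : Matrix ι ι ℂ := Eᴴ * O * E with hA
  have hAH : Aᴴ = A := by
    simp only [hA, conjTranspose_mul, conjTranspose_conjTranspose, hO.eq, Matrix.mul_assoc]
  have hAs : ∀ x y, A y x = star (A x y) := by
    intro x y
    conv_lhs => rw [← hAH]
    rfl
  set w : ι → ι → ℝ := fun x y => (p x - p y) / (p x + p y) with hw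
  set W : Matrix ι ι ℂ := Matrix.of fun x y => (w x y : ℂ) * A x y with hW
  have hwa : ∀ x y, w y x = - w x y := by
    intro x y; simp only [hw]; rw [add_comm (p y), ← neg_div, neg_sub]
  have hWH : Wᴴ = -W := by
    ext x y
    simp only [hW, conjTranspose_apply, of_apply, star_mul', hwa x y, hAs x y, star_star]
    simp
  set X : Matrix ι ι ℂ := E * W * Eᴴ with hX
  have hXH : Xᴴ = -X := by
    simp only [hX, conjTranspose_mul, conjTranspose_conjTranspose, hWH, Matrix.mul_assoc,
      Matrix.neg_mul, Matrix.mul_neg]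
  set R : Matrix ι ι ℂ := -(2:ℂ) • (O * X) - Xᴴ * X with hR
  have htr : ∑ x, p x * (star (e x) ⬝ᵥ R *ᵥ e x).re = ∑ ν, q ν * (star (Ψ ν) ⬝ᵥ R *ᵥ Ψ ν).re := by
    have h := congrArg (fun Z => (R * Z).trace.re) hρ
    simp only [Matrix.mul_sum, Matrix.trace_sum, Matrix.mul_smul, Matrix.trace_smul, tr_form,
      Complex.re_sum, smul_eq_mul, Complex.re_ofReal_mul] at h
    exact h
  have hν : ∀ ν, (star (Ψ ν) ⬝ᵥ R *ᵥ Ψ ν).re ≤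
      (star (O *ᵥ Ψ ν - (a ν : ℂ) • Ψ ν) ⬝ᵥ (O *ᵥ Ψ ν - (a ν : ℂ) • Ψ ν)).re := by
    intro ν
    set u := Ψ ν
    set v := O *ᵥ u - (a ν : ℂ) • u with hv
    have h0 : 0 ≤ (star (v + X *ᵥ u) ⬝ᵥ (v + X *ᵥ u)).re :=
      re_self_nonneg _
    have hstar : ∀ (Z : Matrix ι ι ℂ) (y : ι → ℂ), star (Z *ᵥ u) ⬝ᵥ y = star u ⬝ᵥ Zᴴ *ᵥ y := by
      intro Z y
      rw [star_mulVec, dotProduct_mulVec]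
    have hsw : (star (X *ᵥ u) ⬝ᵥ v).re = (star v ⬝ᵥ X *ᵥ u).re := by
      rw [star_dotProduct v]
      simp
    have him : (star u ⬝ᵥ X *ᵥ u).re = 0 := by
      have h1 : star (star u ⬝ᵥ X *ᵥ u) = - (star u ⬝ᵥ X *ᵥ u) := by
        rw [← star_dotProduct, hstar, hXH, neg_mulVec, dotProduct_neg]
      have := congrArg Complex.re h1
      simp at this
      linarith
    have hvX : (star v ⬝ᵥ X *ᵥ u).re = (star u ⬝ᵥ (O * X) *ᵥ u).re := by
      rw [hv, star_sub, sub_dotProduct, hstar, hO.eq, star_smul, smul_dotProduct, mulVec_mulVec]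
      simp [him]
    have hXX : star (X *ᵥ u) ⬝ᵥ X *ᵥ u = star u ⬝ᵥ (Xᴴ * X) *ᵥ u := by
      rw [hstar, mulVec_mulVec]
    rw [star_add, add_dotProduct, dotProduct_add, dotProduct_add, hXX] at h0
    simp only [Complex.add_re, hsw, hvX] at h0
    rw [hR, sub_mulVec, dotProduct_sub, smul_mulVec, dotProduct_smul]
    simp only [Complex.sub_re, smul_eq_mul, Complex.mul_re, Complex.neg_re, Complex.neg_im,
      Complex.re_ofNat, Complex.im_ofNat]
    linarith
  have hER : Eᴴ * R * E = -(2:ℂ) • (A * W) - Wᴴ * W := by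
    have h1 : Eᴴ * (O * X) * E = A * W := by
      simp only [hX, hA, Matrix.mul_assoc, hEE, Matrix.mul_one]
    have h2 : Eᴴ * (Xᴴ * X) * E = Wᴴ * W := by
      calc _ = (Eᴴ * E) * Wᴴ * (Eᴴ * E) * W * (Eᴴ * E) := by
            simp only [hX, conjTranspose_mul, conjTranspose_conjTranspose, Matrix.mul_assoc]
        _ = _ := by simp [hEE]
    rw [hR, Matrix.mul_sub, Matrix.sub_mul, h2, Matrix.mul_smul, Matrix.smul_mul, h1]
  have hee : ∀ x, (star (e x) ⬝ᵥ R *ᵥ e x).re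
      = ∑ y, (2 * w x y - w x y ^ 2) * Complex.normSq (A x y) := by
    intro x
    rw [hform, hER, hWH]
    simp only [Matrix.sub_apply, Matrix.smul_apply, Matrix.mul_apply, Matrix.neg_apply, Complex.sub_re, smul_eq_mul,
      Finset.mul_sum, Complex.re_sum]
    rw [← Finset.sum_sub_distrib]
    apply Finset.sum_congr rfl
    intro y _
    simp only [hW, of_apply, hAs x y, hwa x y, Complex.normSq_apply]
    simp
    ring
  have hF : QFI p e O = 4 * ∑ x, p x * (star (e x) ⬝ᵥ R *ᵥ e x).re := by
    have h1 : ∑ x, p x * (star (e x) ⬝ᵥ R *ᵥ e x).re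
        = ∑ x, ∑ y, p x * (2 * w x y - w x y ^ 2) * Complex.normSq (A x y) := by
      apply Finset.sum_congr rfl
      intro x _
      rw [hee, Finset.mul_sum]
      simp only [mul_assoc]
    have h2 : ∑ x, ∑ y, p x * (2 * w x y - w x y ^ 2) * Complex.normSq (A x y)
      = ∑ x, ∑ y, p y * (-2 * w x y - w x y ^ 2) * Complex.normSq (A x y) := by
      rw [Finset.sum_comm]
      apply Finset.sum_congr rfl
      intro x _
      apply Finset.sum_congr rfl
      intro y _
      rw [hwa x y, hAs x y]
      have : Complex.normSq (star (A x y)) = Complex.normSq (A x y) := Complex.normSq_conj _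
      rw [this]
      ring
    have h3 : QFI p e O = 2 * (∑ x, ∑ y, p x * (2 * w x y - w x y ^ 2) * Complex.normSq (A x y)
       + ∑ x, ∑ y, p y * (-2 * w x y - w x y ^ 2) * Complex.normSq (A x y)) := by
      unfold QFI
      rw [← Finset.sum_add_distrib]
      congr 1
      apply Finset.sum_congr rfl
      intro x _
      rw [← Finset.sum_add_distrib]
      apply Finset.sum_congr rfl
      intro y _
      rw [hform O x y]
      split_ifs with h
      · simp only [hw]
        field_simp
        ring
      · have hx := hp x
        have hy := hp y
        have h1 : p x = 0 := by linarith
        have h2 : p y = 0 := by linarith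
        simp [h1, h2]
    rw [h3, ← h2, h1]
    ring
  rw [hF, htr]
  refine mul_le_mul_of_nonneg_left (Finset.sum_le_sum fun ν _ => ?_) (by norm_num)
  exact mul_le_mul_of_nonneg_left (hν ν) (hq ν)

lemma lop_mulVec {N : ℕ} {d : Fin N → ℕ} (i : Fin N)
    (A : Matrix (Fin (d i)) (Fin (d i)) ℂ) (Ψ : (∀ j, Fin (d j)) → ℂ) (x : ∀ j, Fin (d j)) :
    (localOp i A *ᵥ Ψ) x = ∑ a, A (x i) a * Ψ (Function.update x i a) := by
  symm
  apply Finset.sum_of_injOn (fun a => Function.update x i a)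
  · intro a _ b _ h
    exact Function.update_injective x i h
  · intro a _; simp
  · intro y _ hy
    simp only [localOp]
    rw [if_neg]
    · simp
    · intro h
      apply hy
      refine ⟨y i, by simp, ?_⟩
      ext1 j
      by_cases hj : j = i
      · subst hj; simp
      · simp [Function.update_of_ne hj, h j hj]
  · intro a _
    simp only [localOp]
    rw [if_pos]
    · simp
    · intro j hj
      simp [Function.update_of_ne hj]

lemma lop_mul {N : ℕ} {d : Fin N → ℕ} (i : Fin N)
    (A B : Matrix (Fin (d i)) (Fin (d i)) ℂ) :
    localOp i (A * B) = localOp i A * localOp i B := by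
  apply Matrix.mulVec_injective
  ext v x
  rw [← mulVec_mulVec, lop_mulVec, lop_mulVec]
  simp only [lop_mulVec, Matrix.mul_apply, Function.update_self, Function.update_idem,
    Finset.sum_mul, Finset.mul_sum]
  rw [Finset.sum_comm]
  simp only [mul_assoc]

lemma lop_conjT {N : ℕ} {d : Fin N → ℕ} (i : Fin N)
    (A : Matrix (Fin (d i)) (Fin (d i)) ℂ) :
    (localOp i A)ᴴ = localOp i Aᴴ := by
  ext x y
  simp only [localOp, conjTranspose_apply, star_mul']
  congr 1
  by_cases h : ∀ j, j ≠ i → x j = y j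
  · rw [if_pos h, if_pos (fun j hj => (h j hj).symm)]; simp
  · rw [if_neg h, if_neg (fun h' => h fun j hj => (h' j hj).symm)]; simp

lemma lop_sub {N : ℕ} {d : Fin N → ℕ} (i : Fin N)
    (A B : Matrix (Fin (d i)) (Fin (d i)) ℂ) :
    localOp i (A - B) = localOp i A - localOp i B := by
  ext x y
  simp only [localOp, Matrix.sub_apply, sub_mul]

lemma lop_smul_one {N : ℕ} {d : Fin N → ℕ} (i : Fin N) (c : ℂ) :
    localOp (d := d) i (c • 1) = c • 1 := by
  apply Matrix.mulVec_injective
  ext v x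
  rw [lop_mulVec, smul_mulVec, one_mulVec, Finset.sum_eq_single (x i)]
  · simp
  · intro b _ hb
    simp [Matrix.one_apply, hb.symm]
  · simp

open scoped ComplexOrder in
lemma herm_psd {n : ℕ} (A : Matrix (Fin n) (Fin n) ℂ) (hA : A.IsHermitian) (lo hi : ℝ)
    (hhi : ∀ μ : ℝ, (∃ v : Fin n → ℂ, v ≠ 0 ∧ A *ᵥ v = (μ : ℂ) • v) → μ ≤ hi)
    (hlo : ∀ μ : ℝ, (∃ v : Fin n → ℂ, v ≠ 0 ∧ A *ᵥ v = (μ : ℂ) • v) → lo ≤ μ) :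
    ∃ C : Matrix (Fin n) (Fin n) ℂ, ((((hi - lo) / 2) ^ 2 : ℝ) : ℂ) • (1 : Matrix (Fin n) (Fin n) ℂ)
      - (A - (((hi + lo) / 2 : ℝ) : ℂ) • 1)ᴴ * (A - (((hi + lo) / 2 : ℝ) : ℂ) • 1) = Cᴴ * C := by
  have hev : ∀ j, ∃ v : Fin n → ℂ, v ≠ 0 ∧ A *ᵥ v = (hA.eigenvalues j : ℂ) • v := by
    intro j
    refine ⟨⇑(hA.eigenvectorBasis j), ?_, ?_⟩
    · intro h
      exact (hA.eigenvectorBasis.orthonormal.ne_zero j) (by ext k; exact congrFun h k)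
    · rw [hA.mulVec_eigenvectorBasis j]
      ext k; simp
  set D : Fin n → ℝ := fun j => Real.sqrt ((hi - hA.eigenvalues j) * (hA.eigenvalues j - lo)) with hD
  have hDD : ∀ j, D j * D j = (hi - hA.eigenvalues j) * (hA.eigenvalues j - lo) := by
    intro j
    apply Real.mul_self_sqrt
    exact mul_nonneg (by linarith [hhi _ (hev j)]) (by linarith [hlo _ (hev j)])
  set U : Matrix (Fin n) (Fin n) ℂ := (hA.eigenvectorUnitary : Matrix (Fin n) (Fin n) ℂ) with hU
  have hUU : Uᴴ * U = 1 := Unitary.coe_star_mul_self hA.eigenvectorUnitary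
  have hUU' : U * Uᴴ = 1 := Unitary.coe_mul_star_self hA.eigenvectorUnitary
  set L : Matrix (Fin n) (Fin n) ℂ := diagonal (fun j => (hA.eigenvalues j : ℂ)) with hL
  have hAU : A = U * L * Uᴴ := by
    have := hA.spectral_theorem
    rw [Unitary.conjStarAlgAut_apply] at this
    exact this
  have hmu : ∀ μ : ℂ, A - μ • 1 = U * (L - μ • 1) * Uᴴ := by
    intro μ
    rw [Matrix.mul_sub, Matrix.sub_mul, ← hAU, Matrix.mul_smul, Matrix.smul_mul, Matrix.mul_one, hUU']
  refine ⟨diagonal (fun j => (D j : ℂ)) * Uᴴ, ?_⟩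
  rw [hmu]
  have hone : (1 : Matrix (Fin n) (Fin n) ℂ) = U * 1 * Uᴴ := by rw [Matrix.mul_one, hUU']
  set μ : ℂ := (((hi + lo) / 2 : ℝ) : ℂ) with hμ
  set r : ℂ := ((((hi - lo) / 2) ^ 2 : ℝ) : ℂ) with hr
  have key : r • (1 : Matrix (Fin n) (Fin n) ℂ) - (L - μ • 1)ᴴ * (L - μ • 1)
      = (diagonal (fun j => (D j : ℂ)))ᴴ * diagonal (fun j => (D j : ℂ)) := by
    rw [hL, smul_one_eq_diagonal, smul_one_eq_diagonal, diagonal_sub, diagonal_conjTranspose,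
      diagonal_conjTranspose, diagonal_mul_diagonal, diagonal_mul_diagonal, diagonal_sub]
    congr 1
    ext j
    have h1 : ((D j : ℂ)) * D j = (((hi - hA.eigenvalues j) * (hA.eigenvalues j - lo) : ℝ) : ℂ) := by
      rw [← hDD]; push_cast; rfl
    simp only [Pi.star_apply, RCLike.star_def, map_sub, Complex.conj_ofReal, hμ, hr, h1]
    push_cast
    ring
  calc _ = U * (r • 1) * Uᴴ - U * ((L - μ • 1)ᴴ * (Uᴴ * U) * (L - μ • 1)) * Uᴴ := by
        rw [Matrix.mul_smul, Matrix.smul_mul, ← hone]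
        simp only [conjTranspose_mul, conjTranspose_conjTranspose, Matrix.mul_assoc]
    _ = U * (r • (1 : Matrix (Fin n) (Fin n) ℂ) - (L - μ • 1)ᴴ * (L - μ • 1)) * Uᴴ := by
        rw [hUU, Matrix.mul_one, Matrix.mul_sub U, Matrix.sub_mul]
    _ = _ := by
        rw [key]
        simp only [conjTranspose_mul, conjTranspose_conjTranspose, Matrix.mul_assoc]

lemma lop_bound {N : ℕ} {d : Fin N → ℕ} (i : Fin N)
    (A : Matrix (Fin (d i)) (Fin (d i)) ℂ) (hA : A.IsHermitian) (lo hi : ℝ)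
    (hhi : ∀ μ : ℝ, (∃ v : Fin (d i) → ℂ, v ≠ 0 ∧ A *ᵥ v = (μ : ℂ) • v) → μ ≤ hi)
    (hlo : ∀ μ : ℝ, (∃ v : Fin (d i) → ℂ, v ≠ 0 ∧ A *ᵥ v = (μ : ℂ) • v) → lo ≤ μ)
    (Ψ : (∀ j, Fin (d j)) → ℂ) (hΨ : star Ψ ⬝ᵥ Ψ = 1) :
    (star (localOp i A *ᵥ Ψ - (((hi + lo) / 2 : ℝ) : ℂ) • Ψ) ⬝ᵥ
      (localOp i A *ᵥ Ψ - (((hi + lo) / 2 : ℝ) : ℂ) • Ψ)).re ≤ ((hi - lo) / 2) ^ 2 := by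
  obtain ⟨C, hC⟩ := herm_psd A hA lo hi hhi hlo
  have h := congrArg (fun Z => star Ψ ⬝ᵥ localOp i Z *ᵥ Ψ) hC
  simp only [lop_sub, lop_mul, ← lop_conjT, lop_smul_one] at h
  have hs : ∀ Z : Matrix (∀ j, Fin (d j)) (∀ j, Fin (d j)) ℂ,
      star Ψ ⬝ᵥ Zᴴ *ᵥ Z *ᵥ Ψ = star (Z *ᵥ Ψ) ⬝ᵥ Z *ᵥ Ψ := by
    intro Z
    rw [star_mulVec, ← dotProduct_mulVec]
  rw [sub_mulVec, ← mulVec_mulVec, ← mulVec_mulVec, dotProduct_sub, hs, hs, smul_mulVec,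
    one_mulVec, dotProduct_smul, hΨ, sub_mulVec, smul_mulVec, one_mulVec] at h
  have h3 := congrArg Complex.re h
  have h4 := re_self_nonneg (localOp i C *ᵥ Ψ)
  rw [← h3, Complex.sub_re, smul_eq_mul, mul_one, Complex.ofReal_re] at h4
  linarith

lemma swap_sum {N : ℕ} {d : Fin N → ℕ} (S : Fin N → Prop) [DecidablePred S]
    (u v u' v' : (∀ j, Fin (d j)) → ℂ)
    (hu : ∀ x y, (∀ j, S j → x j = y j) → u x = u y)
    (hu' : ∀ x y, (∀ j, S j → x j = y j) → u' x = u' y)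
    (hv : ∀ x y, (∀ j, ¬ S j → x j = y j) → v x = v y)
    (hv' : ∀ x y, (∀ j, ¬ S j → x j = y j) → v' x = v' y) :
    (∑ x, u x * v x) * (∑ x, u' x * v' x) = (∑ x, u x * v' x) * (∑ x, u' x * v x) := by
  rw [Finset.sum_mul_sum, Finset.sum_mul_sum, ← Fintype.sum_prod_type',
    ← Fintype.sum_prod_type']
  let T : ((∀ j, Fin (d j)) × (∀ j, Fin (d j))) → ((∀ j, Fin (d j)) × (∀ j, Fin (d j))) :=
    fun z => (fun j => if S j then z.1 j else z.2 j, fun j => if S j then z.2 j else z.1 j)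
  have hT : Function.Involutive T := by
    intro z
    ext j
    · by_cases h : S j <;> simp [T, h]
    · by_cases h : S j <;> simp [T, h]
  apply Fintype.sum_equiv hT.toPerm
  intro z
  have e1 : u (T z).1 = u z.1 := hu _ _ fun j hj => by simp [T, hj]
  have e2 : u' (T z).2 = u' z.2 := hu' _ _ fun j hj => by simp [T, hj]
  have e3 : v (T z).2 = v z.1 := hv _ _ fun j hj => by simp [T, hj]
  have e4 : v' (T z).1 = v' z.2 := hv' _ _ fun j hj => by simp [T, hj]
  simp only [Function.Involutive.coe_toPerm, e1, e2, e3, e4]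
  ring

lemma cov_zero {N : ℕ} {d : Fin N → ℕ} {M : ℕ} (c : Fin N → Fin M)
    (φ : ∀ m : Fin M, ((∀ i : {i : Fin N // c i = m}, Fin (d i.val)) → ℂ))
    (Ψ : (∀ j, Fin (d j)) → ℂ) (hφ : ∀ x, Ψ x = ∏ m, φ m (fun i => x i.val))
    (hΨ : star Ψ ⬝ᵥ Ψ = 1) (i j : Fin N) (hij : c i ≠ c j)
    (A : Matrix (Fin (d i)) (Fin (d i)) ℂ) (A' : Matrix (Fin (d j)) (Fin (d j)) ℂ) :
    star (localOp i A *ᵥ Ψ) ⬝ᵥ (localOp j A' *ᵥ Ψ)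
      = (star (localOp i A *ᵥ Ψ) ⬝ᵥ Ψ) * (star Ψ ⬝ᵥ (localOp j A' *ᵥ Ψ)) := by
  classical
  set F : (∀ j, Fin (d j)) → ℂ := fun x => φ (c i) (fun k => x k.val) with hF
  set G : (∀ j, Fin (d j)) → ℂ := fun x => ∏ m ∈ Finset.univ.erase (c i), φ m (fun k => x k.val) with hG
  have hFG : ∀ x, Ψ x = F x * G x := by
    intro x
    rw [hφ, hF, hG]
    exact (Finset.mul_prod_erase _ (fun m => φ m (fun k => x k.val)) (Finset.mem_univ (c i))).symm
  have hFd : ∀ x y : (∀ j, Fin (d j)), (∀ k, c k = c i → x k = y k) → F x = F y := by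
    intro x y h
    simp only [hF]
    congr 1
    ext1 k
    exact h k.1 k.2
  have hGd : ∀ x y : (∀ j, Fin (d j)), (∀ k, ¬ c k = c i → x k = y k) → G x = G y := by
    intro x y h
    simp only [hG]
    apply Finset.prod_congr rfl
    intro m hm
    congr 1
    ext1 k
    apply h k.1
    rw [k.2]
    exact (Finset.mem_erase.1 hm).1
  set F' : (∀ j, Fin (d j)) → ℂ := fun x => ∑ a, A (x i) a * F (Function.update x i a) with hF'
  set G' : (∀ j, Fin (d j)) → ℂ := fun x => ∑ a, A' (x j) a * G (Function.update x j a) with hG'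
  have hF'd : ∀ x y : (∀ j, Fin (d j)), (∀ k, c k = c i → x k = y k) → F' x = F' y := by
    intro x y h
    simp only [hF']
    rw [h i rfl]
    apply Finset.sum_congr rfl
    intro a _
    congr 1
    apply hFd
    intro k hk
    by_cases hki : k = i
    · subst hki; simp
    · simp [Function.update_of_ne hki, h k hk]
  have hG'd : ∀ x y : (∀ j, Fin (d j)), (∀ k, ¬ c k = c i → x k = y k) → G' x = G' y := by
    intro x y h
    simp only [hG']
    rw [h j hij.symm]
    apply Finset.sum_congr rfl
    intro a _
    congr 1
    apply hGd
    intro k hk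
    by_cases hki : k = j
    · subst hki; simp
    · simp [Function.update_of_ne hki, h k hk]
  have h1 : ∀ x, (localOp i A *ᵥ Ψ) x = F' x * G x := by
    intro x
    rw [lop_mulVec, hF', Finset.sum_mul]
    apply Finset.sum_congr rfl
    intro a _
    rw [hFG, hGd (Function.update x i a) x, mul_assoc]
    intro k hk
    exact Function.update_of_ne (fun h => hk (by rw [h])) _ _
  have h2 : ∀ x, (localOp j A' *ᵥ Ψ) x = F x * G' x := by
    intro x
    rw [lop_mulVec, hG', Finset.mul_sum]
    apply Finset.sum_congr rfl
    intro a _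
    rw [hFG, hFd (Function.update x j a) x]
    · ring
    · intro k hk
      exact Function.update_of_ne (fun h => hij (by rw [← hk, h])) _ _
  have hsw := swap_sum (d := d) (fun k => c k = c i) (fun x => star (F' x) * F x)
    (fun x => star (G x) * G' x) (fun x => star (F x) * F x) (fun x => star (G x) * G x)
    (fun x y h => by simp only [hF'd x y h, hFd x y h])
    (fun x y h => by simp only [hFd x y h])
    (fun x y h => by simp only [hG'd x y h, hGd x y h])
    (fun x y h => by simp only [hGd x y h])
  have e0 : ∑ x, (star (F x) * F x) * (star (G x) * G x) = 1 := by
    rw [← hΨ]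
    simp only [dotProduct, Pi.star_apply, hFG, star_mul']
    exact Finset.sum_congr rfl fun x _ => by ring
  rw [e0, mul_one] at hsw
  simp only [dotProduct, Pi.star_apply, h1, h2, hFG, star_mul']
  convert hsw using 1
  · exact Finset.sum_congr rfl fun x _ => by ring
  · congr 1
    · exact Finset.sum_congr rfl fun x _ => by ring
    · exact Finset.sum_congr rfl fun x _ => by ring

open scoped InnerProductSpace in
lemma pure_bound {N : ℕ} {d : Fin N → ℕ} (B : Finset (Fin N))
    (O : ∀ i, Matrix (Fin (d i)) (Fin (d i)) ℂ)
    (hO : ∀ i ∈ B, (O i).IsHermitian)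
    (lo hi : Fin N → ℝ)
    (hhi : ∀ i ∈ B, IsGreatest
      {μ : ℝ | ∃ v : Fin (d i) → ℂ, v ≠ 0 ∧ (O i).mulVec v = (μ : ℂ) • v} (hi i))
    (hlo : ∀ i ∈ B, IsLeast
      {μ : ℝ | ∃ v : Fin (d i) → ℂ, v ≠ 0 ∧ (O i).mulVec v = (μ : ℂ) • v} (lo i))
    (g : Fin B.card → Fin N) (hginj : Function.Injective g) (hgB : ∀ j, g j ∈ B)
    (Δ : ℕ → ℝ) (hΔ : ∀ j : Fin B.card, Δ j.val = hi (g j) - lo (g j))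
    (hdesc : ∀ m n : ℕ, m ≤ n → n < B.card → Δ n ≤ Δ m)
    (k' : ℕ) (hk' : 1 ≤ k')
    (Ψ : (∀ i, Fin (d i)) → ℂ) (hΨ : star Ψ ⬝ᵥ Ψ = 1) (hprodu : ProducibleIn d B k' Ψ) :
    ∃ a : ℝ, 4 * (star ((∑ i ∈ B, localOp i (O i)) *ᵥ Ψ - (a : ℂ) • Ψ) ⬝ᵥ
      ((∑ i ∈ B, localOp i (O i)) *ᵥ Ψ - (a : ℂ) • Ψ)).re ≤ Fbound B.card k' Δ := by
  classical
  obtain ⟨M, c, hc, φ, hφ⟩ := hprodu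
  have hin : ∀ u v : (∀ i, Fin (d i)) → ℂ,
      ⟪WithLp.toLp 2 u, WithLp.toLp 2 v⟫_ℂ = star u ⬝ᵥ v := by
    intro u v
    rw [EuclideanSpace.inner_toLp_toLp, dotProduct_comm]
  have hnorm : ∀ u : (∀ i, Fin (d i)) → ℂ, ‖WithLp.toLp 2 u‖ ^ 2 = (star u ⬝ᵥ u).re := by
    intro u
    rw [← hin, ← inner_self_eq_norm_sq (𝕜 := ℂ)]
    rfl
  set w : Fin N → EuclideanSpace ℂ (∀ i, Fin (d i)) :=
    fun i => WithLp.toLp 2 (localOp i (O i) *ᵥ Ψ) with hw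
  set ψ : EuclideanSpace ℂ (∀ i, Fin (d i)) := WithLp.toLp 2 Ψ with hψ
  have hψ1 : ‖ψ‖ = 1 := by
    have h := hnorm Ψ
    rw [hΨ, Complex.one_re] at h
    exact (pow_eq_one_iff_of_nonneg (norm_nonneg ψ) two_ne_zero).1 h
  have hnn : ∀ i ∈ B, lo i ≤ hi i := fun i hi' => (hlo i hi').2 (hhi i hi').1
  have key := hil ψ hψ1 B c w
    (fun i _ j _ hij => by
      simp only [hw, hψ, hin]
      exact cov_zero c φ Ψ hφ hΨ i j hij _ _)
    (fun i => (((hi i + lo i) / 2 : ℝ) : ℂ)) (fun i => (hi i - lo i) / 2)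
    (fun i hi' => by
      have h := lop_bound i (O i) (hO i hi') (lo i) (hi i) (fun μ h => (hhi i hi').2 h)
        (fun μ h => (hlo i hi').2 h) Ψ hΨ
      rw [← hnorm] at h
      have h' := abs_le_of_sq_le_sq h (by linarith [hnn i hi'])
      exact (le_abs_self _).trans h')
  have hreal : ∀ i ∈ B, ((⟪ψ, w i⟫_ℂ).re : ℂ) = ⟪ψ, w i⟫_ℂ := by
    intro i hi'
    rw [← Complex.conj_eq_iff_re]
    simp only [hw, hψ, hin]
    change star _ = _
    rw [← star_dotProduct, star_mulVec, ← dotProduct_mulVec, lop_conjT, (hO i hi').eq]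
  refine ⟨∑ i ∈ B, (⟪ψ, w i⟫_ℂ).re, ?_⟩
  rw [← hnorm]
  have e1 : WithLp.toLp 2 ((∑ i ∈ B, localOp i (O i)) *ᵥ Ψ
        - ((∑ i ∈ B, (⟪ψ, w i⟫_ℂ).re : ℝ) : ℂ) • Ψ)
      = ∑ i ∈ B, w i - (∑ i ∈ B, ⟪ψ, w i⟫_ℂ) • ψ := by
    rw [Complex.ofReal_sum, Finset.sum_congr rfl hreal, Matrix.sum_mulVec, WithLp.toLp_sub,
      WithLp.toLp_sum, WithLp.toLp_smul]
  rw [e1]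
  have himg : Finset.univ.map ⟨g, hginj⟩ = B := by
    apply Finset.eq_of_subset_of_card_le
    · intro x hx
      simp only [Finset.mem_map, Finset.mem_univ, true_and, Function.Embedding.coeFn_mk] at hx
      obtain ⟨j, rfl⟩ := hx
      exact hgB j
    · simp
  have hcomb := comb B.card M k' hk' (c ∘ g)
    (fun m => by
      refine le_trans ?_ (hc m)
      apply Finset.card_le_card_of_injOn g
      · intro j hj
        simpa [hgB j] using hj
      · exact hginj.injOn)
    Δ hdesc (fun j hj => by
      have := hΔ ⟨j, hj⟩
      simp only at this
      rw [this]
      linarith [hnn _ (hgB ⟨j, hj⟩)])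
  refine le_trans ?_ hcomb
  refine (mul_le_mul_of_nonneg_left key (by norm_num)).trans (le_of_eq ?_)
  rw [Finset.mul_sum]
  apply Finset.sum_congr rfl
  intro m _
  have e2 : ∑ i ∈ B with c i = m, (hi i - lo i) / 2
      = (∑ j with (c ∘ g) j = m, Δ (j : Fin B.card).val) / 2 := by
    conv_lhs => rw [← himg]
    rw [Finset.sum_filter, Finset.sum_map, Finset.sum_filter, Finset.sum_div]
    apply Finset.sum_congr rfl
    intro j _
    simp only [Function.Embedding.coeFn_mk, Function.comp, hΔ]
    split_ifs <;> simp
  rw [e2]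
  ring

/-- Theorem 3: for a distinguished subset `B` of the `N` particles
of size `N_B = B.card` carrying Hermitian local operators with spectral widths
enumerated in descending order `Δ_1 ≥ ⋯ ≥ Δ_{N_B}` (via the enumeration `g`), and
`O_B = Σ_{i∈B} Õ_i`, if the density matrix
`ρ = Σ_l p_l |e_l⟩⟨e_l| = Σ_ν q_ν |Ψ_ν⟩⟨Ψ_ν|` is `k'`-producible in the `N_B`
particles of `B`, then `F_Q[ρ, O_B] ≤ F_B(k';{Δ_i})`. -/
theorem stmt10 {N : ℕ} (hN : 1 ≤ N) {d : Fin N → ℕ} (B : Finset (Fin N))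
    (O : ∀ i, Matrix (Fin (d i)) (Fin (d i)) ℂ)
    (hO : ∀ i ∈ B, (O i).IsHermitian)
    (lo hi : Fin N → ℝ)
    (hhi : ∀ i ∈ B, IsGreatest
      {μ : ℝ | ∃ v : Fin (d i) → ℂ, v ≠ 0 ∧ (O i).mulVec v = (μ : ℂ) • v} (hi i))
    (hlo : ∀ i ∈ B, IsLeast
      {μ : ℝ | ∃ v : Fin (d i) → ℂ, v ≠ 0 ∧ (O i).mulVec v = (μ : ℂ) • v} (lo i))
    (g : Fin B.card → Fin N) (hginj : Function.Injective g) (hgB : ∀ j, g j ∈ B)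
    (Δ : ℕ → ℝ) (hΔ : ∀ j : Fin B.card, Δ j.val = hi (g j) - lo (g j))
    (hdesc : ∀ m n : ℕ, m ≤ n → n < B.card → Δ n ≤ Δ m)
    (k' : ℕ) (hk' : 1 ≤ k') (hk'NB : k' ≤ B.card)
    (p : (∀ i, Fin (d i)) → ℝ) (e : (∀ i, Fin (d i)) → (∀ i, Fin (d i)) → ℂ)
    (horth : ∀ x y, star (e x) ⬝ᵥ e y = if x = y then 1 else 0)
    (hp : ∀ x, 0 ≤ p x) (hpsum : ∑ x, p x = 1)
    (K : ℕ) (q : Fin K → ℝ) (Ψ : Fin K → (∀ i, Fin (d i)) → ℂ)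
    (hq : ∀ ν, 0 ≤ q ν) (hqsum : ∑ ν, q ν = 1)
    (hΨunit : ∀ ν, star (Ψ ν) ⬝ᵥ Ψ ν = 1)
    (hprodu : ∀ ν, ProducibleIn d B k' (Ψ ν))
    (hρ : ∑ x, (p x : ℂ) • Matrix.vecMulVec (e x) (star (e x))
        = ∑ ν, (q ν : ℂ) • Matrix.vecMulVec (Ψ ν) (star (Ψ ν))) :
    QFI p e (∑ i ∈ B, localOp i (O i)) ≤ Fbound B.card k' Δ := by
  choose a ha using fun ν => pure_bound B O hO lo hi hhi hlo g hginj hgB Δ hΔ hdesc k' hk'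
    (Ψ ν) (hΨunit ν) (hprodu ν)
  have hOB : (∑ i ∈ B, localOp i (O i)).IsHermitian := by
    unfold Matrix.IsHermitian
    rw [Matrix.conjTranspose_sum]
    refine Finset.sum_congr rfl fun i hi' => ?_
    rw [lop_conjT, (hO i hi').eq]
  refine (qfi_le p e _ hOB horth hp K q Ψ hq a hρ).trans ?_
  rw [Finset.mul_sum]
  calc _ ≤ ∑ ν, q ν * Fbound B.card k' Δ := by
        refine Finset.sum_le_sum fun ν _ => ?_
        rw [mul_left_comm]
        exact mul_le_mul_of_nonneg_left (ha ν) (hq ν)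
    _ = _ := by rw [← Finset.sum_mul, hqsum, one_mul]
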